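/- arXiv:math/0509518 — 2 statements merged into one kernel-verified Lean document; each statement's English description precedes it below -/
import Mathlib

section
/- Let ψ : [0,∞) → ℝ be continuous with ψ(0) = 0, twice differentiable on (0,∞), and suppose the second derivative ψ'' is completely monotone on (0,∞). Then there exist α ∈ ℝ, β ≥ 0 and a Borel measure Π on (0,∞) with ∫_{(0,∞)} min(1, x²) Π(dx) < ∞ such that ψ(c) = α c + β c² + ∫_{(0,∞)} ( e^{-cx} − 1 + c x 1_{{x<1}} ) Π(dx) for all c ≥ 0. -/
open MeasureTheory

/-- A function is completely monotone on `(0,∞)` if it is infinitely differentiable there and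
`(-1)^n f^{(n)} ≥ 0` on `(0,∞)` for every `n`. -/
def CompletelyMonotoneOn (f : ℝ → ℝ) : Prop :=
  ContDiffOn ℝ (⊤ : ℕ∞) f (Set.Ioi 0) ∧
    ∀ (n : ℕ), ∀ x ∈ Set.Ioi (0 : ℝ), 0 ≤ (-1 : ℝ) ^ n * iteratedDerivWithin n f (Set.Ioi 0) x


open Polynomial Filter Topology in
lemma hm_desc_aux (n k : ℕ) (hk : k ≤ n) (j : ℕ) :
    (n:ℝ) * ((k:ℝ)^j - (k.descFactorial j : ℝ)) ≤ (j:ℝ)^2 * (n:ℝ)^j ∧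
      (k.descFactorial j : ℝ) ≤ (k:ℝ)^j := by
  refine ⟨?_, by exact_mod_cast Nat.descFactorial_le_pow k j⟩
  induction j with
  | zero => simp
  | succ j ih =>
    rw [Nat.descFactorial_succ]
    have h1 : (k.descFactorial j : ℝ) ≤ (n:ℝ)^j := by
      exact_mod_cast (Nat.descFactorial_le_pow k j).trans (Nat.pow_le_pow_left hk j)
    have h2 : (k:ℝ) - j ≤ ((k - j : ℕ) : ℝ) := by
      have : k ≤ (k - j) + j := by omega
      have : (k:ℝ) ≤ ((k - j : ℕ) : ℝ) + j := by exact_mod_cast this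
      linarith
    have h3 : (0:ℝ) ≤ k.descFactorial j := by positivity
    have hkn : (k:ℝ) ≤ n := by exact_mod_cast hk
    have h4 : (k.descFactorial j : ℝ) ≤ (k:ℝ)^j := by exact_mod_cast Nat.descFactorial_le_pow k j
    have hn : (0:ℝ) ≤ n := by positivity
    have hj : (0:ℝ) ≤ j := by positivity
    push_cast
    calc (n:ℝ) * ((k:ℝ)^(j+1) - ((k-j : ℕ):ℝ) * k.descFactorial j)
        ≤ n * ((k:ℝ)^(j+1) - (k - j) * k.descFactorial j) := by gcongr
      _ = n * ((k:ℝ) * (k^j - k.descFactorial j) + j * k.descFactorial j) := by ring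
      _ ≤ n * ((n:ℝ) * (k^j - k.descFactorial j) + j * n^j) := by
          gcongr
      _ = n * (n * (k^j - k.descFactorial j)) + n * (j * n^j) := by ring
      _ ≤ n * (j^2 * n^j) + n * (j * n^j) := by gcongr
      _ ≤ (j+1)^2 * n^(j+1) := by
          have : (0:ℝ) ≤ n^(j+1) := by positivity
          have e : (j+1)^2 * (n:ℝ)^(j+1) - (n * (j^2 * n^j) + n * (j * n^j)) = (j+1) * n^(j+1) := by
            ring
          nlinarith [mul_nonneg (add_nonneg hj zero_le_one) this]

open Polynomial in
lemma hm_poly_aux (n j : ℕ) :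
    ∑ k ∈ Finset.range (n+1), ((n.choose k : ℝ) * (k.descFactorial j : ℝ)) •
      (X^k * (1 - X)^(n-k) : ℝ[X]) = (n.descFactorial j : ℝ) • (X^j : ℝ[X]) := by
  rcases lt_or_ge n j with h | h
  · rw [Nat.descFactorial_of_lt h]
    simp only [Nat.cast_zero, zero_smul]
    apply Finset.sum_eq_zero
    intro k hk
    rw [Nat.descFactorial_of_lt (by simp at hk; omega)]
    simp
  obtain ⟨N, rfl⟩ := Nat.exists_eq_add_of_le h
  rw [add_assoc, Finset.sum_range_add]
  rw [Finset.sum_eq_zero (s := Finset.range j), zero_add]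
  · have key : ∀ i ∈ Finset.range (N+1), (((j+N).choose (j+i) : ℝ) * ((j+i).descFactorial j : ℝ)) •
      (X^(j+i) * (1 - X)^(j+N-(j+i)) : ℝ[X]) = ((j+N).descFactorial j : ℝ) • (X^j : ℝ[X]) *
        (X^i * (1-X)^(N-i) * (N.choose i : ℝ[X])) := by
      intro i hi
      have e := Nat.choose_mul (n := j+N) (k := j+i) (s := j) (by omega)
      have e2 : (j+N).choose (j+i) * (j+i).descFactorial j = (j+N).descFactorial j * N.choose i := by
        rw [Nat.descFactorial_eq_factorial_mul_choose, Nat.descFactorial_eq_factorial_mul_choose]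
        simp only [Nat.add_sub_cancel_left] at e
        calc _ = j.factorial * ((j+N).choose (j+i) * (j+i).choose j) := by ring
          _ = _ := by rw [e]; ring
      have e3 : ((j+N).choose (j+i) : ℝ) * ((j+i).descFactorial j : ℝ) =
        ((j+N).descFactorial j : ℝ) * (N.choose i : ℝ) := by exact_mod_cast e2
      rw [e3, Nat.add_sub_add_left, smul_eq_C_mul, smul_eq_C_mul]
      simp only [map_mul, pow_add, map_natCast]
      ring
    rw [Finset.sum_congr rfl key, ← Finset.mul_sum, ← add_pow]
    simp
  · intro k hk
    rw [Nat.descFactorial_of_lt (by simpa using hk)]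
    simp

open Polynomial Filter Topology in
lemma hm_hausdorff (L : ℝ[X] →ₗ[ℝ] ℝ) (hL : ∀ m k, 0 ≤ L (X^k*(1-X)^m)) :
    ∃ μ : Measure unitInterval, IsFiniteMeasure μ ∧ ∀ k : ℕ, ∫ u, (u:ℝ)^k ∂μ = L (X^k) := by
  set w : ℕ → ℕ → ℝ := fun n k => (n.choose k : ℝ) * L (X^k*(1-X)^(n-k)) with hw
  have w0 : ∀ n k, 0 ≤ w n k := fun n k => mul_nonneg (by positivity) (hL _ _)
  have hsum : ∀ n j, ∑ k ∈ Finset.range (n+1), w n k * (k.descFactorial j : ℝ) =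
      (n.descFactorial j : ℝ) * L (X^j) := by
    intro n j
    have := congrArg L (hm_poly_aux n j)
    rw [map_sum, map_smul, smul_eq_mul] at this
    rw [← this]
    apply Finset.sum_congr rfl
    intro k _
    rw [map_smul, smul_eq_mul]
    simp only [hw]; ring
  have hsum0 : ∀ n, ∑ k ∈ Finset.range (n+1), w n k = L 1 := by
    intro n; simpa using hsum n 0
  have hL1 : 0 ≤ L 1 := by simpa using hL 0 0
  let pt : ℕ → ℕ → unitInterval := fun n k => Set.projIcc 0 1 zero_le_one ((k:ℝ)/n)
  let M : ℕ → Measure unitInterval := fun n =>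
    ∑ k ∈ Finset.range (n+1), ENNReal.ofReal (w n k) • Measure.dirac (pt n k)
  have hMmass : ∀ n, M n Set.univ = ENNReal.ofReal (L 1) := by
    intro n
    simp only [M, Measure.coe_finsetSum, Finset.sum_apply, Measure.smul_apply, measure_univ,
      smul_eq_mul, mul_one]
    rw [← ENNReal.ofReal_sum_of_nonneg (fun k _ => w0 n k), hsum0]
  have hMfin : ∀ n, IsFiniteMeasure (M n) := fun n => ⟨by rw [hMmass]; exact ENNReal.ofReal_lt_top⟩
  have hMint : ∀ n (f : C(unitInterval, ℝ)), ∫ u, f u ∂(M n) =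
      ∑ k ∈ Finset.range (n+1), w n k * f (pt n k) := by
    intro n f
    simp only [M]
    rw [integral_finsetSum_measure]
    · apply Finset.sum_congr rfl
      intro k _
      rw [integral_smul_measure, integral_dirac, ENNReal.toReal_ofReal (w0 n k), smul_eq_mul]
    · intro k _
      exact (f.continuous.integrable_of_hasCompactSupport (HasCompactSupport.of_compactSpace _)).smul_measure (by simp)
  let F : ℕ → FiniteMeasure unitInterval := fun n => ⟨M n, hMfin n⟩
  have hF : ∀ n, F n ∈ {μ : FiniteMeasure unitInterval | μ.mass ≤ (L 1).toNNReal} := by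
    intro n
    simp only [Set.mem_ofPred_eq, FiniteMeasure.mass]
    rw [← ENNReal.coe_le_coe, FiniteMeasure.ennreal_coeFn_eq_coeFn_toMeasure]
    change M n Set.univ ≤ _
    rw [hMmass]; rfl
  obtain ⟨μ, -, hμ⟩ := isCompact_iff_ultrafilter_le_nhds'.1
    (isCompact_setOfPred_finiteMeasure_le_of_compactSpace unitInterval (L 1).toNNReal)
    ((Filter.hyperfilter ℕ).map F) (by
      rw [Ultrafilter.mem_map]
      exact Filter.univ_mem' hF)
  have hμ' : Tendsto F (Filter.hyperfilter ℕ : Filter ℕ) (𝓝 μ) := hμ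
  rw [FiniteMeasure.tendsto_iff_forall_integral_tendsto] at hμ'
  refine ⟨μ, inferInstance, fun j => ?_⟩
  let f : C(unitInterval, ℝ) := ⟨fun u => (u:ℝ)^j, by fun_prop⟩
  have h1 := hμ' (BoundedContinuousFunction.mkOfCompact f)
  have h2 : Tendsto (fun n => ∫ u, f u ∂(M n)) atTop (𝓝 (L (X^j))) := by
    have hj : 0 ≤ L (X^j) := by simpa using hL 0 j
    rw [tendsto_iff_dist_tendsto_zero]
    have hlim : Tendsto (fun n : ℕ => ((j:ℝ)^2 * (L 1 + L (X^j))) / (n:ℝ)) atTop (𝓝 0) :=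
      tendsto_const_div_atTop_nhds_zero_nat _
    refine squeeze_zero' (Eventually.of_forall fun _ => dist_nonneg) ?_ hlim
    filter_upwards [eventually_gt_atTop 0] with n hn
    have hn' : (0:ℝ) < n := by exact_mod_cast hn
    rw [hMint, Real.dist_eq]
    have hpt : ∀ k ∈ Finset.range (n+1), w n k * f (pt n k) = w n k * (k:ℝ)^j / (n:ℝ)^j := by
      intro k hk
      have hk' : (k:ℝ) ≤ n := by
        have : k ≤ n := by simp at hk; omega
        exact_mod_cast this
      have : ((pt n k : unitInterval) : ℝ) = k / n := by
        simp only [pt]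
        rw [Set.projIcc_of_mem zero_le_one (x := (k:ℝ)/n) ⟨by positivity, by rw [div_le_one hn']; exact hk'⟩]
      simp only [f, ContinuousMap.coe_mk, this, div_pow]
      ring
    rw [Finset.sum_congr rfl hpt, ← Finset.sum_div]
    set S := ∑ k ∈ Finset.range (n+1), w n k * (k:ℝ)^j with hS
    have hA : 0 ≤ S - (n.descFactorial j : ℝ) * L (X^j) := by
      rw [← hsum, hS, ← Finset.sum_sub_distrib]
      refine Finset.sum_nonneg fun k hk => ?_
      have := (hm_desc_aux n k (by simp at hk; omega) j).2
      nlinarith [w0 n k]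
    have hB : n * (S - (n.descFactorial j : ℝ) * L (X^j)) ≤ j^2 * n^j * L 1 := by
      rw [← hsum, hS, ← Finset.sum_sub_distrib, ← hsum0 n, Finset.mul_sum, Finset.mul_sum]
      refine Finset.sum_le_sum fun k hk => ?_
      have := (hm_desc_aux n k (by simp at hk; omega) j).1
      nlinarith [w0 n k]
    obtain ⟨hC, hD⟩ := hm_desc_aux n n le_rfl j
    have hnj : (0:ℝ) < n^j := by positivity
    have hC' := mul_le_mul_of_nonneg_right hC hj
    have hD' := mul_le_mul_of_nonneg_right hD hj
    have hj1 : 0 ≤ (j:ℝ)^2 * n^j * L 1 := by positivity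
    have hj2 : 0 ≤ (j:ℝ)^2 * n^j * L (X^j) := by positivity
    have e : S / (n:ℝ)^j - L (X^j) = (S - n^j * L (X^j)) / n^j := by field_simp
    rw [e, abs_div, abs_of_pos hnj, div_le_div_iff₀ hnj hn', ← abs_of_pos hn', ← abs_mul, abs_of_pos hn', abs_le]
    constructor <;> nlinarith
  exact tendsto_nhds_unique h1 (h2.mono_left (Nat.hyperfilter_le_atTop))

open Polynomial in
lemma hm_unique (μ ν : Measure unitInterval) [IsFiniteMeasure μ] [IsFiniteMeasure ν]
    (h : ∀ k : ℕ, ∫ u, (u:ℝ)^k ∂μ = ∫ u, (u:ℝ)^k ∂ν) : μ = ν := by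
  have int : ∀ (ρ : Measure unitInterval) [IsFiniteMeasure ρ] (f : C(unitInterval, ℝ)), Integrable f ρ :=
    fun ρ _ f => f.continuous.integrable_of_hasCompactSupport (HasCompactSupport.of_compactSpace _)
  have hp : ∀ p : ℝ[X], ∫ u : unitInterval, p.eval (u:ℝ) ∂μ = ∫ u : unitInterval, p.eval (u:ℝ) ∂ν := by
    intro p
    have ip : ∀ (ρ : Measure unitInterval) [IsFiniteMeasure ρ] (p : ℝ[X]),
      Integrable (fun u : unitInterval => p.eval (u:ℝ)) ρ :=
      fun ρ _ p => int ρ ⟨fun u => p.eval (u:ℝ), by fun_prop⟩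
    induction p using Polynomial.induction_on' with
    | add p q hp hq =>
      simp only [eval_add]
      rw [integral_add (ip _ _) (ip _ _), integral_add (ip _ _) (ip _ _), hp, hq]
    | monomial n a =>
      simp only [eval_monomial, integral_const_mul, h]
  have hc : ∀ ρ : Measure unitInterval, IsFiniteMeasure ρ → Continuous fun f : C(unitInterval, ℝ) => ∫ u, f u ∂ρ := by
    intro ρ _
    refine continuous_iff_continuousAt.2 fun f => ?_
    rw [ContinuousAt, tendsto_iff_dist_tendsto_zero]
    have : Filter.Tendsto (fun g : C(unitInterval, ℝ) => dist g f * ρ.real Set.univ) (nhds f) (nhds (0 * ρ.real Set.univ)) := by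
      apply Filter.Tendsto.mul_const
      exact tendsto_iff_dist_tendsto_zero.1 Filter.tendsto_id
    rw [zero_mul] at this
    refine squeeze_zero (fun _ => dist_nonneg) (fun g => ?_) this
    rw [dist_eq_norm, ← integral_sub (int _ _) (int _ _)]
    refine norm_integral_le_of_norm_le_const (Filter.Eventually.of_forall fun u => ?_)
    rw [← dist_eq_norm]; exact ContinuousMap.dist_apply_le_dist u
  have hall : ∀ f : C(unitInterval, ℝ), ∫ u, f u ∂μ = ∫ u, f u ∂ν := by
    have hcl : IsClosed {f : C(unitInterval, ℝ) | ∫ u, f u ∂μ = ∫ u, f u ∂ν} :=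
      isClosed_eq (hc μ inferInstance) (hc ν inferInstance)
    intro f
    have hf := continuousMap_mem_polynomialFunctions_closure 0 1 f
    refine hcl.closure_subset_iff.2 ?_ hf
    rintro _ ⟨p, -, rfl⟩
    exact hp p
  exact ext_of_forall_integral_eq_of_IsFiniteMeasure fun f => hall f.toContinuousMap

/-- Functions continuous on `[0,∞)`, smooth on `(0,∞)`, with completely monotone second derivative. -/
def HMQ (ψ : ℝ → ℝ) : Prop :=
  ContinuousOn ψ (Set.Ici 0) ∧ ∃ d : ℕ → ℝ → ℝ, d 0 = ψ ∧
    (∀ n, ∀ x, 0 < x → HasDerivAt (d n) (d (n+1) x) x) ∧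
    ∀ n, ∀ x, 0 < x → 0 ≤ (-1:ℝ)^n * d (n+2) x

lemma HMQ.shift {ψ : ℝ → ℝ} (hψ : HMQ ψ) {h : ℝ} (hh : 0 < h) :
    HMQ (fun x => ψ x - ψ (x + h)) := by
  obtain ⟨hc, d, rfl, hd, hs⟩ := hψ
  refine ⟨hc.sub (hc.comp (by fun_prop) ?_), fun n x => d n x - d n (x + h), rfl, ?_, ?_⟩
  · intro x hx
    simp only [Set.mem_Ici] at *
    linarith
  · intro n x hx
    exact (hd n x hx).sub ((hd n (x+h) (by linarith)).comp_add_const x h)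
  · intro n x hx
    have hanti : AntitoneOn (fun y => (-1:ℝ)^n * d (n+2) y) (Set.Ioi 0) := by
      refine antitoneOn_of_deriv_nonpos (convex_Ioi 0) ?_ ?_ ?_
      · intro y hy
        exact ((hd (n+2) y hy).const_mul _).continuousAt.continuousWithinAt
      · intro y hy
        rw [interior_Ioi] at hy
        exact ((hd (n+2) y hy).const_mul _).differentiableAt.differentiableWithinAt
      · intro y hy
        rw [interior_Ioi] at hy
        rw [((hd (n+2) y hy).const_mul _).deriv]
        have := hs (n+1) y hy
        rw [pow_succ] at this
        have e : n + 1 + 2 = n + 2 + 1 := by ring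
        rw [e] at this
        linarith
    have := hanti (a := x) (b := x + h) hx (by simp only [Set.mem_Ioi]; linarith) (by linarith)
    simp only at this
    linarith

lemma HMQ.second_diff {ψ : ℝ → ℝ} (hψ : HMQ ψ) {c h : ℝ} (hc : 0 ≤ c) (hh : 0 < h) :
    0 ≤ ψ (c + 2 * h) - 2 * ψ (c + h) + ψ c := by
  obtain ⟨hcont, d, rfl, hd, hs⟩ := hψ
  have hconv : ConvexOn ℝ (Set.Ici 0) (d 0) := by
    refine convexOn_of_hasDerivWithinAt2_nonneg (convex_Ici 0) hcont (f' := d 1) (f'' := d 2) ?_ ?_ ?_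
    · intro x hx; rw [interior_Ici] at *; exact (hd 0 x hx).hasDerivWithinAt
    · intro x hx; rw [interior_Ici] at *; exact (hd 1 x hx).hasDerivWithinAt
    · intro x hx; rw [interior_Ici] at *; simpa using hs 0 x hx
  have hc2 : c + 2 * h ∈ Set.Ici (0:ℝ) := by simp only [Set.mem_Ici]; linarith
  have := hconv.2 (Set.mem_Ici.2 hc) hc2
    (show (0:ℝ) ≤ 1/2 by norm_num) (show (0:ℝ) ≤ 1/2 by norm_num) (by norm_num)
  simp only [smul_eq_mul] at this
  rw [show 1/2 * c + 1/2 * (c + 2 * h) = c + h by ring] at this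
  linarith

open Polynomial in
lemma HMQ.pos_functional (h : ℝ) (hh : 0 < h) (m : ℕ) : ∀ (ψ : ℝ → ℝ), HMQ ψ →
    ∀ (L : ℝ[X] →ₗ[ℝ] ℝ),
    (∀ k : ℕ, L (X^k) = ψ (k * h + 2 * h) - 2 * ψ (k * h + h) + ψ (k * h)) →
    ∀ k, 0 ≤ L (X^k * (1-X)^m) := by
  induction m with
  | zero =>
    intro ψ hψ L hL k
    simp only [pow_zero, mul_one, hL]
    exact hψ.second_diff (by positivity) hh
  | succ m ih =>
    intro ψ hψ L hL k
    have := ih _ (hψ.shift hh) (L ∘ₗ LinearMap.mulLeft ℝ (1 - X)) ?_ k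
    · simp only [LinearMap.comp_apply, LinearMap.mulLeft_apply] at this
      convert this using 2
      ring
    · intro k
      simp only [LinearMap.comp_apply, LinearMap.mulLeft_apply, sub_mul, one_mul, map_sub]
      rw [← pow_succ', hL, hL]
      push_cast
      ring_nf

open Polynomial in
lemma HMQ.measure {ψ : ℝ → ℝ} (hψ : HMQ ψ) {h : ℝ} (hh : 0 < h) :
    ∃ μ : Measure unitInterval, IsFiniteMeasure μ ∧ ∀ k : ℕ, ∫ u, (u:ℝ)^k ∂μ =
      ψ (k * h + 2 * h) - 2 * ψ (k * h + h) + ψ (k * h) := by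
  let a : ℕ → ℝ := fun k => ψ (k * h + 2 * h) - 2 * ψ (k * h + h) + ψ (k * h)
  let L : ℝ[X] →ₗ[ℝ] ℝ := (Polynomial.basisMonomials ℝ).constr ℝ a
  have hL : ∀ k, L (X^k) = a k := by
    intro k
    have := (Polynomial.basisMonomials ℝ).constr_basis ℝ a k
    rw [Polynomial.coe_basisMonomials] at this
    rw [X_pow_eq_monomial]
    exact this
  obtain ⟨μ, hμ, hμ2⟩ := hm_hausdorff L (fun m k => HMQ.pos_functional h hh m ψ hψ L hL k)
  exact ⟨μ, hμ, fun k => by rw [hμ2, hL]⟩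

lemma hm_consistent (ψ : ℝ → ℝ) (m : ℕ) (hm : 0 < m) (ρ τ : Measure unitInterval)
    [IsFiniteMeasure ρ] [IsFiniteMeasure τ]
    (hρ : ∀ k : ℕ, ∫ u, (u:ℝ)^k ∂ρ = ψ (k + 2) - 2 * ψ (k + 1) + ψ k)
    (hτ : ∀ k : ℕ, ∫ u, (u:ℝ)^k ∂τ =
      ψ ((k + 2) / m) - 2 * ψ ((k + 1) / m) + ψ (k / m))
    (k : ℕ) (G : unitInterval → ℝ) (hG : Measurable G)
    (hGs : ∀ u : unitInterval, (∑ i ∈ Finset.range m, (u:ℝ)^i)^2 * G (u^m) = (u:ℝ)^k) :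
    Integrable G ρ ∧ ∫ v, G v ∂ρ = ψ ((k + 2) / m) - 2 * ψ ((k + 1) / m) + ψ (k / m) := by
  have intp : ∀ j : ℕ, Integrable (fun u : unitInterval => (u:ℝ)^j) τ := fun j =>
    (show Continuous (fun u : unitInterval => (u:ℝ)^j) by fun_prop).integrable_of_hasCompactSupport
      (HasCompactSupport.of_compactSpace _)
  have hm' : (m:ℝ) ≠ 0 := by positivity
  let s : unitInterval → NNReal := fun u => Real.toNNReal ((∑ i ∈ Finset.range m, (u:ℝ)^i)^2)
  have hs : Measurable s := by fun_prop
  have hsr : ∀ u (y : ℝ), s u • y = (∑ i ∈ Finset.range m, (u:ℝ)^i)^2 * y := by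
    intro u y
    rw [NNReal.smul_def, Real.coe_toNNReal _ (sq_nonneg _), smul_eq_mul]
  let T := τ.withDensity (fun u => (s u : ENNReal))
  have hpm : Measurable (fun u : unitInterval => u^m) :=
    (show Continuous (fun u : unitInterval => u^m) by fun_prop).measurable
  have hTfin : IsFiniteMeasure T := by
    apply isFiniteMeasure_withDensity_ofReal
    refine Integrable.hasFiniteIntegral (μ := τ) ?_
    exact (show Continuous (fun u : unitInterval => (∑ i ∈ Finset.range m, (u:ℝ)^i)^2) by fun_prop).integrable_of_hasCompactSupport
      (HasCompactSupport.of_compactSpace _)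
  have hmap : ρ = T.map (fun u : unitInterval => u^m) := by
    apply hm_unique
    intro k
    rw [integral_map hpm.aemeasurable
      (show Continuous (fun u : unitInterval => (u:ℝ)^k) by fun_prop).aestronglyMeasurable,
      integral_withDensity_eq_integral_smul hs, hρ]
    simp only [hsr]
    have e : ∀ u : unitInterval, (∑ i ∈ Finset.range m, (u:ℝ)^i)^2 * ((u^m : unitInterval) : ℝ)^k =
        ∑ i ∈ Finset.range m, ∑ j ∈ Finset.range m, (u:ℝ)^(m*k+i+j) := by
      intro u
      rw [sq, Finset.sum_mul_sum, Finset.sum_mul]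
      refine Finset.sum_congr rfl fun i _ => ?_
      rw [Finset.sum_mul]
      refine Finset.sum_congr rfl fun j _ => ?_
      simp only [pow_add, pow_mul]
      push_cast
      ring
    simp only [e]
    rw [integral_finsetSum _ (fun i _ => integrable_finsetSum _ (fun j _ => intp _))]
    simp only [integral_finsetSum _ (fun j _ => intp _), hτ]
    let b : ℕ → ℝ := fun l => ψ (l / m)
    have e1 : ∀ i : ℕ, ∑ j ∈ Finset.range m, (ψ ((((m*k+i+j : ℕ):ℝ) + 2)/m) -
        2 * ψ ((((m*k+i+j : ℕ):ℝ) + 1)/m) + ψ (((m*k+i+j : ℕ):ℝ)/m)) =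
        (b (m*k+m+(i+1)) - b (m*k+m+i)) - (b (m*k+(i+1)) - b (m*k+i)) := by
      intro i
      have := Finset.sum_range_sub (fun j => b (m*k+i+j+1) - b (m*k+i+j)) m
      simp only [add_zero] at this
      rw [show m*k+m+(i+1) = m*k+i+m+1 by ring, show m*k+m+i = m*k+i+m by ring,
        show m*k+(i+1) = m*k+i+1 by ring, ← this]
      refine Finset.sum_congr rfl fun j _ => ?_
      simp only [b]
      push_cast
      ring_nf
    simp only [e1]
    rw [Finset.sum_sub_distrib, Finset.sum_range_sub (fun i => b (m*k+m+i)),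
      Finset.sum_range_sub (fun i => b (m*k+i))]
    simp only [b, add_zero]
    push_cast
    rw [show ((m:ℝ)*k+m+m)/m = k+2 by field_simp; ring, show ((m:ℝ)*k+m)/m = k+1 by field_simp,
      show ((m:ℝ)*k)/m = k by field_simp]
    ring
  constructor
  · rw [hmap, integrable_map_measure hG.aestronglyMeasurable hpm.aemeasurable,
      integrable_withDensity_iff_integrable_smul hs]
    simp only [Function.comp_apply, hsr, hGs]
    exact intp k
  · rw [hmap, integral_map hpm.aemeasurable hG.aestronglyMeasurable,
      integral_withDensity_eq_integral_smul hs]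
    simp only [hsr, hGs, hτ]

lemma hm_affine (D : ℝ → ℝ) (D0 : D 0 = 0) (hcont : ∀ R, ContinuousOn D (Set.Icc 0 R))
    (hD : ∀ m : ℕ, 0 < m → ∀ k : ℕ,
      D ((k + 2) / m) - 2 * D ((k + 1) / m) + D (k / m) = 0) (c : ℝ) (hc : 0 ≤ c) :
    D c = D 1 * c := by
  have h1 : ∀ m : ℕ, 0 < m → ∀ k : ℕ, D (k / m) = k * D (1 / m) ∧
      D ((k + 1) / m) = (k + 1) * D (1 / m) := by
    intro m hm k
    induction k with
    | zero => simp [D0]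
    | succ k ih =>
      have := hD m hm k
      push_cast
      refine ⟨ih.2, ?_⟩
      rw [show (k:ℝ) + 1 + 1 = k + 2 by ring]
      linarith [ih.1, ih.2]
  have h2 : ∀ m : ℕ, 0 < m → ∀ k : ℕ, D (k / m) = D 1 * (k / m) := by
    intro m hm k
    have hm' : (m:ℝ) ≠ 0 := by positivity
    have e := (h1 m hm m).1
    rw [div_self hm'] at e
    rw [(h1 m hm k).1, e]
    field_simp
  have ht : Filter.Tendsto (fun n : ℕ => ((⌊c * (n:ℝ)⌋₊ : ℝ) / (n:ℝ))) Filter.atTop (nhds c) :=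
    (tendsto_nat_floor_mul_div_atTop hc).comp tendsto_natCast_atTop_atTop
  have ht2 : Filter.Tendsto (fun n : ℕ => ((⌊c * (n:ℝ)⌋₊ : ℝ) / (n:ℝ))) Filter.atTop
      (nhdsWithin c (Set.Icc 0 c)) := by
    refine tendsto_nhdsWithin_iff.2 ⟨ht, Filter.eventually_atTop.2 ⟨1, fun n hn => ⟨by positivity, ?_⟩⟩⟩
    have : (0:ℝ) < n := by exact_mod_cast hn
    rw [div_le_iff₀ this]
    exact Nat.floor_le (by positivity)
  have l1 := (hcont c c ⟨hc, le_rfl⟩).tendsto.comp ht2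
  have l2 := ht.const_mul (D 1)
  refine tendsto_nhds_unique l1 (l2.congr' ?_)
  filter_upwards [Filter.eventually_gt_atTop 0] with n hn
  exact (h2 n hn _).symm

lemma hm_q_bound (c x : ℝ) (hc : 0 ≤ c) (hx : 0 < x) :
    ‖Real.exp (-(c * x)) - 1 + (if x < 1 then c * x else 0)‖ ≤ (c^2 + 1) * min 1 (x^2) := by
  have hcx : 0 ≤ c * x := by positivity
  have h1 : Real.exp (-(c*x)) ≤ 1 := by rw [Real.exp_le_one_iff]; linarith
  have h0 := Real.exp_pos (-(c*x))
  have h2 := Real.add_one_le_exp (-(c*x))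
  rw [Real.norm_eq_abs, abs_le]
  split_ifs with h
  · have hm : min 1 (x^2) = x^2 := min_eq_right (by nlinarith)
    rw [hm]
    have h3 : Real.exp (-(c*x)) ≤ 1 - c*x + (c*x)^2 := by
      have := Real.add_one_le_exp (c*x)
      have e : Real.exp (-(c*x)) * Real.exp (c*x) = 1 := by rw [← Real.exp_add]; simp
      have : Real.exp (-(c*x)) * (1 + c*x) ≤ 1 := by nlinarith
      have h4 : 1 ≤ (1 - c*x + (c*x)^2) * (1 + c*x) := by nlinarith [pow_nonneg hcx 3]
      have h5 : (0:ℝ) < 1 + c*x := by positivity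
      exact le_of_mul_le_mul_right (this.trans h4) h5
    constructor <;> nlinarith [sq_nonneg (c*x), sq_nonneg x]
  · have hm : min 1 (x^2) = 1 := min_eq_left (by nlinarith)
    rw [hm]
    constructor <;> nlinarith [sq_nonneg c]

lemma hm_weight_bound (v : ℝ) (h0 : 0 < v) (h1 : v < 1) :
    ((1 - v)^2)⁻¹ * min 1 ((-Real.log v)^2) ≤ 4 := by
  set x := -Real.log v with hx
  have hx0 : 0 < x := by rw [hx]; linarith [Real.log_neg h0 h1]
  have hv : v * (1 + x) ≤ 1 := by
    have e : v * Real.exp x = 1 := by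
      rw [hx, Real.exp_neg, Real.exp_log h0]; field_simp
    nlinarith [Real.add_one_le_exp x]
  have h2 : 0 < 1 - v := by linarith
  rw [inv_mul_le_iff₀ (by positivity)]
  rcases le_total x 1 with h | h
  · have : x ≤ 2 * (1 - v) := by nlinarith
    exact (min_le_right _ _).trans (by nlinarith)
  · have : 1 ≤ 2 * (1 - v) := by nlinarith
    exact (min_le_left _ _).trans (by nlinarith)

/-- The kernel used to compare the scales `1` and `1/m`. -/
noncomputable def hmG (m k : ℕ) (v : ℝ) : ℝ :=
  if v = 1 then ((m:ℝ)^2)⁻¹ else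
    ((1 - v)^2)⁻¹ * (v ^ ((k:ℝ)/m) * (1 - v ^ ((1:ℝ)/m))^2)

lemma hmG_meas (m k : ℕ) : Measurable (hmG m k) := by
  unfold hmG
  refine Measurable.ite (measurableSet_singleton (1:ℝ)) measurable_const ?_
  fun_prop

lemma hmG_eq (m k : ℕ) (hm : 0 < m) (u : ℝ) (h0 : 0 ≤ u) (h1 : u ≤ 1) :
    (∑ i ∈ Finset.range m, u^i)^2 * hmG m k (u^m) = u^k := by
  have hm' : (m:ℝ) ≠ 0 := by positivity
  unfold hmG
  rcases h1.eq_or_lt with rfl | h1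
  · simp [hm']
  · have hum : u^m < 1 := pow_lt_one₀ h0 h1 hm.ne'
    rw [if_neg hum.ne]
    have e : ∀ j : ℕ, (u^m) ^ ((j:ℝ)/m) = u^j := by
      intro j
      rw [← Real.rpow_natCast u m, ← Real.rpow_mul h0, mul_div_cancel₀ _ hm', Real.rpow_natCast]
    have e1 := e 1
    rw [Nat.cast_one, pow_one] at e1
    rw [e, e1]
    have g := geom_sum_mul u m
    have g2 : (∑ i ∈ Finset.range m, u^i)^2 * (1 - u)^2 = (1 - u^m)^2 := by
      rw [← mul_pow, ← sub_sq_comm, ← g]; ring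
    have h3 : (1 - u^m)^2 ≠ 0 := by
      have : 0 < 1 - u^m := by linarith
      positivity
    calc _ = u^k * (((1 - u^m)^2)⁻¹ * ((∑ i ∈ Finset.range m, u^i)^2 * (1 - u)^2)) := by ring
      _ = u^k := by rw [g2, inv_mul_cancel₀ h3, mul_one]

lemma hmG_nonneg (m k : ℕ) (v : ℝ) (hv : 0 ≤ v) : 0 ≤ hmG m k v := by
  unfold hmG
  split_ifs
  · positivity
  · have := Real.rpow_nonneg hv ((k:ℝ)/m)
    positivity

theorem levy_khintchine_aux (ψ : ℝ → ℝ) (hψ : HMQ ψ) (h0 : ψ 0 = 0) :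
    ∃ (α β : ℝ) (ν : Measure ℝ), 0 ≤ β ∧ ν (Set.Iic 0) = 0 ∧
      (∫⁻ x, ENNReal.ofReal (min 1 (x ^ 2)) ∂ν) < ⊤ ∧
      ∀ c : ℝ, 0 ≤ c →
        ψ c = α * c + β * c ^ 2
          + ∫ x, (Real.exp (-(c * x)) - 1 + (if x < 1 then c * x else 0)) ∂ν := by
  obtain ⟨ρ, hρf, hρ⟩ := hψ.measure one_pos
  have hcont : ContinuousOn ψ (Set.Ici 0) := hψ.1
  simp only [mul_one] at hρ
  -- the scale comparison
  have hG : ∀ m : ℕ, 0 < m → ∀ k : ℕ, Integrable (fun v : unitInterval => hmG m k v) ρ ∧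
      ∫ v : unitInterval, hmG m k v ∂ρ =
        ψ ((k + 2) / m) - 2 * ψ ((k + 1) / m) + ψ (k / m) := by
    intro m hm k
    have hm' : (0:ℝ) < 1 / m := by positivity
    obtain ⟨τ, hτf, hτ⟩ := hψ.measure hm'
    refine hm_consistent ψ m hm ρ τ hρ ?_ k _ ((hmG_meas m k).comp measurable_subtype_coe) ?_
    · intro k
      rw [hτ]
      congr 3 <;> ring_nf
    · intro u
      have := hmG_eq m k hm u u.2.1 u.2.2
      simpa using this
  -- no mass at zero
  have hρ0 : ρ {0} = 0 := by
    have hle : ∀ m : ℕ, 0 < m → ρ.real {0} ≤ ψ (2 / m) - 2 * ψ (1 / m) := by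
      intro m hm
      obtain ⟨hi, he⟩ := hG m hm 0
      simp only [Nat.cast_zero, zero_add, zero_div, h0, add_zero] at he
      rw [← he]
      have hm' : (m:ℝ) ≠ 0 := by positivity
      have e : ∫ v in ({0} : Set unitInterval), hmG m 0 (v:ℝ) ∂ρ = ρ.real {0} := by
        rw [integral_singleton]
        simp [hmG, Real.zero_rpow (inv_ne_zero hm')]
      rw [← e]
      exact setIntegral_le_integral hi (Filter.Eventually.of_forall fun v => hmG_nonneg m 0 v v.2.1)
    have hlim : Filter.Tendsto (fun m : ℕ => ψ (2 / m) - 2 * ψ (1 / m)) Filter.atTop (nhds 0) := by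
      have hl : ∀ a : ℝ, 0 ≤ a → Filter.Tendsto (fun m : ℕ => ψ (a / m)) Filter.atTop (nhds 0) := by
        intro a ha
        have := (hcont 0 Set.self_mem_Ici).tendsto
        rw [h0] at this
        refine this.comp (tendsto_nhdsWithin_iff.2 ⟨tendsto_const_div_atTop_nhds_zero_nat a, ?_⟩)
        exact Filter.Eventually.of_forall fun n => by
          simp only [Set.mem_Ici]; positivity
      have := (hl 2 (by norm_num)).sub ((hl 1 (by norm_num)).const_mul 2)
      simpa using this
    have : ρ.real {0} ≤ 0 := ge_of_tendsto hlim
      (Filter.eventually_atTop.2 ⟨1, fun m hm => hle m hm⟩)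
    have h' : ρ.real {0} = 0 := le_antisymm this measureReal_nonneg
    rwa [measureReal_eq_zero_iff] at h'
  let S : Set unitInterval := {v | 0 < (v:ℝ) ∧ (v:ℝ) < 1}
  have hS : MeasurableSet S := by
    have : S = (fun v : unitInterval => (v:ℝ)) ⁻¹' (Set.Ioo 0 1) := rfl
    rw [this]; exact measurable_subtype_coe measurableSet_Ioo
  let wt : unitInterval → NNReal := fun v => Real.toNNReal (((1 - (v:ℝ))^2)⁻¹)
  have hwt : Measurable wt := by fun_prop
  have hwtr : ∀ v (y : ℝ), wt v • y = ((1 - (v:ℝ))^2)⁻¹ * y := by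
    intro v y
    rw [NNReal.smul_def, Real.coe_toNNReal _ (by positivity), smul_eq_mul]
  let W := (ρ.restrict S).withDensity (fun v => (wt v : ENNReal))
  let lg : unitInterval → ℝ := fun v => -Real.log v
  have hlg : Measurable lg := by fun_prop
  let ν : Measure ℝ := W.map lg
  have hWS : ∀ᵐ v ∂W, v ∈ S :=
    (withDensity_absolutelyContinuous _ _).ae_le (ae_restrict_mem hS)
  have hνpos : ∀ᵐ x ∂ν, 0 < x := by
    rw [ae_map_iff hlg.aemeasurable measurableSet_Ioi]
    filter_upwards [hWS] with v hv
    have := Real.log_neg hv.1 hv.2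
    simp only [lg]; linarith
  have hνint : ∀ g : ℝ → ℝ, Measurable g →
      ∫ x, g x ∂ν = ∫ v in S, ((1 - (v:ℝ))^2)⁻¹ * g (-Real.log v) ∂ρ := by
    intro g hg
    rw [integral_map hlg.aemeasurable hg.aestronglyMeasurable,
      integral_withDensity_eq_integral_smul hwt]
    simp only [hwtr, lg]
  have hνfin : (∫⁻ x, ENNReal.ofReal (min 1 (x ^ 2)) ∂ν) < ⊤ := by
    rw [lintegral_map (by fun_prop) hlg, lintegral_withDensity_eq_lintegral_mul _ (by fun_prop) (by fun_prop)]
    refine lt_of_le_of_lt (setLIntegral_mono (g := fun _ => ENNReal.ofReal 4) (by fun_prop) ?_) ?_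
    · intro v hv
      have := hm_weight_bound v hv.1 hv.2
      simp only [Pi.mul_apply, lg]
      change ENNReal.ofReal _ * _ ≤ _
      rw [← ENNReal.ofReal_mul (by positivity)]
      exact ENNReal.ofReal_le_ofReal this
    · rw [lintegral_const]
      exact ENNReal.mul_lt_top ENNReal.ofReal_lt_top (measure_lt_top _ _)
  have hminint : Integrable (fun x : ℝ => min 1 (x^2)) ν := by
    refine ⟨by fun_prop, ?_⟩
    rw [hasFiniteIntegral_iff_ofReal (Filter.Eventually.of_forall fun x => by positivity)]
    exact hνfin
  let q : ℝ → ℝ → ℝ := fun c x => Real.exp (-(c * x)) - 1 + (if x < 1 then c * x else 0)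
  have hqm : ∀ c, Measurable (q c) := by
    intro c
    refine Measurable.add (by fun_prop) ?_
    exact Measurable.ite measurableSet_Iio (by fun_prop) measurable_const
  have hqi : ∀ c, 0 ≤ c → Integrable (q c) ν := by
    intro c hc
    refine (hminint.const_mul (c^2+1)).mono' (hqm c).aestronglyMeasurable ?_
    filter_upwards [hνpos] with x hx
    exact hm_q_bound c x hc hx
  have hqc : ∀ R, ContinuousOn (fun c => ∫ x, q c x ∂ν) (Set.Icc 0 R) := by
    intro R
    refine continuousOn_of_dominated (bound := fun x => (R^2+1) * min 1 (x^2))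
      (fun c _ => (hqm c).aestronglyMeasurable) ?_ (hminint.const_mul _) ?_
    · intro c hc
      filter_upwards [hνpos] with x hx
      refine (hm_q_bound c x hc.1 hx).trans ?_
      have := hc.1
      have := hc.2
      gcongr
    · refine Filter.Eventually.of_forall fun x => ?_
      simp only [q]
      split_ifs <;> fun_prop
  set β : ℝ := ρ.real {1} / 2 with hβ
  let D : ℝ → ℝ := fun c => ψ c - β * c^2 - ∫ x, q c x ∂ν
  have hDaff := hm_affine D ?_ ?_ ?_
  · refine ⟨D 1, β, ν, by positivity, ?_, hνfin, ?_⟩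
    · have : Set.Iic (0:ℝ) = {x | ¬ 0 < x} := by ext; simp
      rw [this]; exact hνpos
    · intro c hc
      have := hDaff c hc
      simp only [D] at this ⊢
      linarith
  · simp [D, q, h0]
  · intro R
    exact ((hcont.mono Set.Icc_subset_Ici_self).sub (by fun_prop)).sub (hqc R)
  · intro m hm k
    obtain ⟨hi, he⟩ := hG m hm k
    have hm' : (0:ℝ) < m := by positivity
    -- second difference of the integral
    have hdiff : (∫ x, q ((k + 2) / m) x ∂ν) - 2 * (∫ x, q ((k + 1) / m) x ∂ν) +
        (∫ x, q (k / m) x ∂ν) = ∫ v in S, hmG m k v ∂ρ := by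
      have i1 := hqi ((k + 2) / m) (by positivity)
      have i2 := hqi ((k + 1) / m) (by positivity)
      have i3 := hqi (k / m) (by positivity)
      have i4 : Integrable (fun x => q ((k + 2) / m) x - 2 * q ((k + 1) / m) x) ν :=
        i1.sub (i2.const_mul 2)
      rw [← integral_const_mul, ← integral_sub i1 (i2.const_mul 2), ← integral_add i4 i3,
        hνint _ (by
          have := hqm ((k + 2) / m)
          have := hqm ((k + 1) / m)
          have := hqm (k / m)
          fun_prop)]
      refine setIntegral_congr_fun hS fun v hv => ?_
      simp only [hmG, if_neg hv.2.ne]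
      congr 1
      rw [Real.rpow_def_of_pos hv.1, Real.rpow_def_of_pos hv.1]
      set t := Real.log (v:ℝ)
      have e1 : Real.exp (-((k + 2) / m * -t)) = Real.exp (t * (k/m)) * Real.exp (t * (1/m))^2 := by
        rw [← Real.exp_nat_mul, ← Real.exp_add]; congr 1; push_cast; ring
      have e2 : Real.exp (-((k + 1) / m * -t)) = Real.exp (t * (k/m)) * Real.exp (t * (1/m)) := by
        rw [← Real.exp_add]; congr 1; ring
      have e3 : Real.exp (-(k / m * -t)) = Real.exp (t * (k/m)) := by congr 1; ring
      simp only [q, e1, e2, e3]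
      split_ifs <;> ring
    have hsplit : ∫ v in S, hmG m k v ∂ρ + ρ.real {1} * ((m:ℝ)^2)⁻¹ =
        ∫ v : unitInterval, hmG m k v ∂ρ := by
      rw [← integral_add_compl hS hi]
      congr 1
      have hae : (Sᶜ : Set unitInterval) =ᵐ[ρ] ({1} : Set unitInterval) := by
        have h00 : ∀ᵐ v ∂ρ, v ≠ 0 := by
          rw [ae_iff]; simpa using hρ0
        filter_upwards [h00] with v hv
        apply propext
        change v ∈ Sᶜ ↔ v ∈ ({1} : Set unitInterval)
        simp only [S, Set.mem_compl_iff, Set.mem_ofPred_eq, Set.mem_singleton_iff, not_and, not_lt]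
        have hv0 : 0 < (v:ℝ) := unitInterval.pos_iff_ne_zero.2 hv
        constructor
        · intro h
          exact Subtype.ext (le_antisymm v.2.2 (h hv0))
        · rintro rfl _
          simp
      rw [setIntegral_congr_set hae, integral_singleton]
      simp [hmG]
    simp only [D]
    have e : β * ((k + 2) / m)^2 - 2 * (β * ((k + 1) / m)^2) + β * (k / m)^2 =
        ρ.real {1} * ((m:ℝ)^2)⁻¹ := by
      rw [hβ]; field_simp; ring
    linarith

/-- A continuous function on `[0,∞)` vanishing at `0`, twice differentiable on `(0,∞)` with
completely monotone second derivative, has a Lévy–Khintchine representation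
`ψ(c) = αc + βc² + ∫ (e^{-cx} - 1 + cx 1_{x<1}) Π(dx)` with `β ≥ 0` and
`∫ min(1,x²) Π(dx) < ∞`. -/
theorem levy_khintchine_of_completely_monotone (ψ : ℝ → ℝ)
    (hcont : ContinuousOn ψ (Set.Ici 0)) (h0 : ψ 0 = 0)
    (hdiff : ∀ x ∈ Set.Ioi (0 : ℝ), DifferentiableWithinAt ℝ ψ (Set.Ioi 0) x ∧
      DifferentiableWithinAt ℝ (derivWithin ψ (Set.Ioi 0)) (Set.Ioi 0) x)
    (hcm : CompletelyMonotoneOn (derivWithin (derivWithin ψ (Set.Ioi 0)) (Set.Ioi 0))) :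
    ∃ (α β : ℝ) (ν : Measure ℝ), 0 ≤ β ∧ ν (Set.Iic 0) = 0 ∧
      (∫⁻ x, ENNReal.ofReal (min 1 (x ^ 2)) ∂ν) < ⊤ ∧
      ∀ c : ℝ, 0 ≤ c →
        ψ c = α * c + β * c ^ 2
          + ∫ x, (Real.exp (-(c * x)) - 1 + (if x < 1 then c * x else 0)) ∂ν := by
  refine levy_khintchine_aux ψ ⟨hcont, fun n => match n with
    | 0 => ψ
    | 1 => derivWithin ψ (Set.Ioi 0)
    | n + 2 => iteratedDerivWithin n (derivWithin (derivWithin ψ (Set.Ioi 0)) (Set.Ioi 0)) (Set.Ioi 0),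
    rfl, ?_, ?_⟩ h0
  · intro n x hx
    have hnhds : Set.Ioi (0:ℝ) ∈ nhds x := Ioi_mem_nhds hx
    match n with
    | 0 => exact (hdiff x hx).1.hasDerivWithinAt.hasDerivAt hnhds
    | 1 =>
      simp only [iteratedDerivWithin_zero]
      exact (hdiff x hx).2.hasDerivWithinAt.hasDerivAt hnhds
    | n + 2 =>
      simp only [iteratedDerivWithin_succ]
      have := hcm.1.differentiableOn_iteratedDerivWithin (m := n)
        (by exact_mod_cast ENat.natCast_lt_top n) (uniqueDiffOn_Ioi 0)
      exact (this x hx).hasDerivWithinAt.hasDerivAt hnhds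
  · intro n x hx
    exact hcm.2 n x hx
end

section
/- Let ψ be a branching mechanism, strictly increasing on [γ,∞) with lim_{c→∞} ψ(c) = ∞, satisfying the extinction condition. Then: (i) for every μ ≥ 0 and w > 0, writing p = ψ^{-1}(μ), the change-of-variables identity ∫_w^∞ dx/( ψ(p+x) − μ ) = ∫_{ψ(p+w) − μ}^∞ dy/( y ψ'(ψ^{-1}(μ + y)) ) holds; (ii) for every fixed t > 0, letting w_μ(t) ∈ (0,∞) denote the unique solution of ∫_{w_μ(t)}^∞ dx/( ψ(ψ^{-1}(μ)+x) − μ ) = t, one has lim_{μ→∞} ( ψ(ψ^{-1}(μ) + w_μ(t)) − μ ) = 0. -/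
open MeasureTheory

/-- `ψ` is a branching mechanism with parameters `(α, β, ν)`:
`ψ(c) = αc + βc² + ∫ (e^{-cx} - 1 + cx 1_{x<1}) ν(dx)` for all `c ≥ 0`, where `β ≥ 0` and
`ν` is a measure on `(0,∞)` with `∫ min(1,x²) ν(dx) < ∞`. -/
def IsBMWith (ψ : ℝ → ℝ) (α β : ℝ) (ν : Measure ℝ) : Prop :=
  0 ≤ β ∧ ν (Set.Iic 0) = 0 ∧ (∫⁻ x, ENNReal.ofReal (min 1 (x ^ 2)) ∂ν) < ⊤ ∧
    ∀ c : ℝ, 0 ≤ c →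
      ψ c = α * c + β * c ^ 2
        + ∫ x, (Real.exp (-(c * x)) - 1 + (if x < 1 then c * x else 0)) ∂ν

/-- `ψ` is a branching mechanism: it is of Lévy–Khintchine form for some parameters. -/
def IsBranchingMechanism (ψ : ℝ → ℝ) : Prop :=
  ∃ (α β : ℝ) (ν : Measure ℝ), IsBMWith ψ α β ν


lemma bm_int_bound {ν : Measure ℝ} (hν : (∫⁻ x, ENNReal.ofReal (min 1 (x ^ 2)) ∂ν) < ⊤) :
    Integrable (fun x : ℝ => min 1 (x ^ 2)) ν := by
  refine ⟨by fun_prop, ?_⟩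
  rw [hasFiniteIntegral_iff_ofReal]
  · exact hν
  · exact Filter.Eventually.of_forall fun x => by positivity

lemma bm_meas {ν : Measure ℝ} (c : ℝ) : AEStronglyMeasurable
    (fun x : ℝ => Real.exp (-(c * x)) - 1 + (if x < 1 then c * x else 0)) ν := by
  refine Measurable.aestronglyMeasurable ?_
  exact Measurable.add (by fun_prop)
    (Measurable.ite measurableSet_Iio (by fun_prop) measurable_const)

lemma bm_ae_pos {ν : Measure ℝ} (h0 : ν (Set.Iic 0) = 0) : ∀ᵐ x ∂ν, 0 < x := by
  rw [ae_iff]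
  convert h0 using 2
  ext x; simp

lemma bm_integrable {ν : Measure ℝ} (h0 : ν (Set.Iic 0) = 0)
    (hν : (∫⁻ x, ENNReal.ofReal (min 1 (x ^ 2)) ∂ν) < ⊤) (c : ℝ) (hc : 0 ≤ c) :
    Integrable (fun x : ℝ => Real.exp (-(c * x)) - 1 + (if x < 1 then c * x else 0)) ν := by
  refine ((bm_int_bound hν).const_mul (c ^ 2 + 1)).mono' (bm_meas c) ?_
  filter_upwards [bm_ae_pos h0] with x hx
  have hcx : 0 ≤ c * x := by positivity
  have h1 := Real.add_one_le_exp (-(c * x))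
  have h2 : Real.exp (-(c * x)) ≤ 1 := Real.exp_le_one_iff.2 (by linarith)
  have h3 := Real.exp_pos (-(c * x))
  rw [Real.norm_eq_abs, abs_le]
  split_ifs with h
  · rw [min_eq_right (by nlinarith)]
    have h4 : Real.exp (-(c * x)) - 1 + c * x ≤ (c * x) ^ 2 := by
      have h5 := Real.add_one_le_exp (c * x)
      have h6 : Real.exp (-(c * x)) * Real.exp (c * x) = 1 := by
        rw [← Real.exp_add]; simp
      have h7 : Real.exp (-(c * x)) * (1 + c * x) ≤ 1 := by nlinarith
      nlinarith
    constructor <;> nlinarith [sq_nonneg x, sq_nonneg (c * x)]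
  · rw [min_eq_left (by nlinarith)]
    constructor <;> nlinarith [sq_nonneg c]

lemma bm_convex {ψ : ℝ → ℝ} {α β : ℝ} {ν : Measure ℝ} (h : IsBMWith ψ α β ν) :
    ConvexOn ℝ (Set.Ici 0) ψ := by
  obtain ⟨hβ, h0, hν, hψ⟩ := h
  refine ⟨convex_Ici 0, ?_⟩
  intro c hc d hd a b ha hb hab
  simp only [Set.mem_Ici, smul_eq_mul] at *
  have hm : 0 ≤ a * c + b * d := by positivity
  rw [hψ _ hm, hψ c hc, hψ d hd]
  have hI := integral_mono (bm_integrable h0 hν _ hm)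
    (((bm_integrable h0 hν c hc).const_mul a).add ((bm_integrable h0 hν d hd).const_mul b)) (by
      intro x
      have h1 := convexOn_exp.2 (Set.mem_univ (-(c * x))) (Set.mem_univ (-(d * x))) ha hb hab
      simp only [smul_eq_mul] at h1
      have h2 : a * -(c * x) + b * -(d * x) = -((a * c + b * d) * x) := by ring
      rw [h2] at h1
      simp only [Pi.add_apply]
      split_ifs <;> nlinarith)
  simp only [Pi.add_apply] at hI
  rw [integral_add ((bm_integrable h0 hν c hc).const_mul a)
    ((bm_integrable h0 hν d hd).const_mul b), integral_const_mul, integral_const_mul] at hI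
  have hq : (a * c + b * d) ^ 2 ≤ a * c ^ 2 + b * d ^ 2 := by
    obtain rfl : b = 1 - a := by linarith
    nlinarith [mul_nonneg (mul_nonneg ha hb) (sq_nonneg (c - d))]
  nlinarith [mul_le_mul_of_nonneg_left hq hβ]

lemma bm_diff {ψ : ℝ → ℝ} {α β : ℝ} {ν : Measure ℝ} (h : IsBMWith ψ α β ν) (c : ℝ)
    (hc : 0 < c) : DifferentiableAt ℝ ψ c := by
  obtain ⟨hβ, h0, hν, hψ⟩ := h
  have key := hasDerivAt_integral_of_dominated_loc_of_deriv_le (𝕜 := ℝ) (μ := ν)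
    (F := fun c x : ℝ => Real.exp (-(c * x)) - 1 + (if x < 1 then c * x else 0))
    (F' := fun c x : ℝ => Real.exp (-(c * x)) * (-x) + (if x < 1 then x else 0))
    (x₀ := c) (s := Set.Ioo (c / 2) (2 * c)) (bound := fun x => (2 * c + 2 / c) * min 1 (x ^ 2))
    (Ioo_mem_nhds (by linarith) (by linarith))
    (Filter.Eventually.of_forall fun c => bm_meas c) (bm_integrable h0 hν c hc.le)
    (Measurable.aestronglyMeasurable (Measurable.add (by fun_prop)
      (Measurable.ite measurableSet_Iio (by fun_prop) measurable_const)))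
    (by
      filter_upwards [bm_ae_pos h0] with x hx d hd
      have hd0 : 0 < d := by linarith [hd.1]
      have hcx : 0 < d * x := by positivity
      have h1 := Real.add_one_le_exp (-(d * x))
      have h2 : Real.exp (-(d * x)) ≤ 1 := Real.exp_le_one_iff.2 (by linarith)
      have h3 := Real.exp_pos (-(d * x))
      have hcc : 0 < 2 / c := by positivity
      rw [Real.norm_eq_abs, abs_le]
      split_ifs with h
      · rw [min_eq_right (by nlinarith)]
        have e1 : x * (1 - Real.exp (-(d * x))) ≤ x * (d * x) := by gcongr; linarith
        have e2 : 0 ≤ x * (1 - Real.exp (-(d * x))) := by apply mul_nonneg <;> linarith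
        have e3 : d * x ^ 2 ≤ 2 * c * x ^ 2 := by gcongr; exact hd.2.le
        have e4 : 0 ≤ 2 / c * x ^ 2 := by positivity
        have e5 : 0 ≤ c * x ^ 2 := by positivity
        constructor <;> nlinarith
      · rw [min_eq_left (by nlinarith)]
        have e1 : Real.exp (-(d * x)) * (d * x) ≤ 1 := by
          have h5 := Real.add_one_le_exp (d * x)
          have h6 : Real.exp (-(d * x)) * Real.exp (d * x) = 1 := by
            rw [← Real.exp_add]; simp
          nlinarith
        have e2 : Real.exp (-(d * x)) * x ≤ 2 / c := by
          rw [le_div_iff₀ hc]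
          have := mul_pos h3 hx
          nlinarith [hd.1]
        have := mul_pos h3 hx
        constructor <;> nlinarith)
    ((bm_int_bound hν).const_mul _)
    (by
      refine Filter.Eventually.of_forall fun x d _ => ?_
      have e1 : HasDerivAt (fun d : ℝ => Real.exp (-(d * x)) - 1)
          (Real.exp (-(d * x)) * (-x)) d := by
        have := (((hasDerivAt_id d).mul_const x).neg.exp).sub_const 1
        simpa using this
      refine e1.add ?_
      split_ifs
      · simpa using (hasDerivAt_id d).mul_const x
      · exact hasDerivAt_const _ _)
  have k2 : DifferentiableAt ℝ (fun c : ℝ => α * c + β * c ^ 2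
        + ∫ x, (Real.exp (-(c * x)) - 1 + (if x < 1 then c * x else 0)) ∂ν) c :=
    DifferentiableAt.add (by fun_prop) key.2.differentiableAt
  refine k2.congr_of_eventuallyEq ?_
  filter_upwards [Ioi_mem_nhds hc] with d hd using hψ d (le_of_lt hd)

/-- Existence and uniqueness of the level of the tail integral. -/
lemma tail_exists_unique (h : ℝ → ℝ) (hpos : ∀ x, 0 < x → 0 < h x)
    (hint : ∀ w, 0 < w → IntegrableOn h (Set.Ioi w)) (K : ℝ) (hK : 0 < K)
    (hKx : ∀ x, 0 < x → x ≤ 1 → (K * x)⁻¹ ≤ h x) (t : ℝ) (ht : 0 < t) :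
    ∃! w : ℝ, 0 < w ∧ (∫ x in Set.Ioi w, h x) = t := by
  have hii : ∀ a b, 0 < a → a ≤ b → IntervalIntegrable h volume a b := fun a b ha hab =>
    (intervalIntegrable_iff_integrableOn_Ioc_of_le hab).2
      ((hint a ha).mono_set Set.Ioc_subset_Ioi_self)
  have hsub : ∀ a b, 0 < a → a ≤ b →
      (∫ x in Set.Ioi a, h x) - (∫ x in Set.Ioi b, h x) = ∫ x in a..b, h x := fun a b ha hab =>
    intervalIntegral.integral_Ioi_sub_Ioi (hint a ha) hab
  have hanti : ∀ a b, 0 < a → a < b → (∫ x in Set.Ioi b, h x) < ∫ x in Set.Ioi a, h x := by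
    intro a b ha hab
    have := intervalIntegral.intervalIntegral_pos_of_pos_on (hii a b ha hab.le)
      (fun x hx => hpos x (ha.trans hx.1)) hab
    linarith [hsub a b ha hab.le]
  have hnn : ∀ a, 0 < a → 0 ≤ ∫ x in Set.Ioi a, h x := fun a ha =>
    setIntegral_nonneg measurableSet_Ioi fun x hx => (hpos x (ha.trans hx)).le
  -- small point
  obtain ⟨a, ha0, ha1, hat⟩ : ∃ a, 0 < a ∧ a ≤ 1 ∧ t ≤ ∫ x in Set.Ioi a, h x := by
    refine ⟨Real.exp (-(K * t)), Real.exp_pos _,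
      Real.exp_le_one_iff.2 (by have := mul_pos hK ht; linarith), ?_⟩
    set a := Real.exp (-(K * t)) with ha
    have ha0 : 0 < a := Real.exp_pos _
    have ha1 : a ≤ 1 := Real.exp_le_one_iff.2 (by have := mul_pos hK ht; linarith)
    have h0 : (0 : ℝ) ∉ Set.uIcc a 1 := by
      rw [Set.uIcc_of_le ha1]; exact fun hx => absurd hx.1 (not_le.2 ha0)
    have e1 : ∫ x in a..1, (K * x)⁻¹ = t := by
      simp_rw [mul_inv]
      rw [intervalIntegral.integral_const_mul, integral_inv h0, Real.log_div one_ne_zero ha0.ne',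
        Real.log_one, ha, Real.log_exp]
      field_simp
      ring
    have e2 : ∫ x in a..1, (K * x)⁻¹ ≤ ∫ x in a..1, h x := by
      refine intervalIntegral.integral_mono_on ha1 ?_ (hii a 1 ha0 ha1)
        fun x hx => hKx x (ha0.trans_le hx.1) hx.2
      refine ContinuousOn.intervalIntegrable ?_
      rw [Set.uIcc_of_le ha1]
      refine ContinuousOn.inv₀ (by fun_prop) fun x hx => ?_
      have := ha0.trans_le hx.1
      positivity
    linarith [hsub a 1 ha0 ha1, hnn 1 one_pos]
  -- large point
  obtain ⟨b, hb1, hbt⟩ : ∃ b, 1 ≤ b ∧ (∫ x in Set.Ioi b, h x) ≤ t := by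
    have := intervalIntegral_tendsto_integral_Ioi 1 (hint 1 one_pos) Filter.tendsto_id
    have h2 := this.eventually (Ioi_mem_nhds (show (∫ x in Set.Ioi 1, h x) - t < _ by linarith))
    obtain ⟨b, hb, hb1⟩ := (h2.and (Filter.eventually_ge_atTop 1)).exists
    refine ⟨b, hb1, ?_⟩
    have h3 := hsub 1 b one_pos hb1
    simp only [id] at hb
    linarith
  have hcont : ContinuousOn (fun b => ∫ x in Set.Ioi b, h x) (Set.Icc a b) :=
    ((hint a ha0).continuousOn_Ici_primitive_Ioi).mono Set.Icc_subset_Ici_self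
  obtain ⟨w, hw, hwt⟩ := intermediate_value_Icc' (ha1.trans hb1) hcont ⟨hbt, hat⟩
  refine ⟨w, ⟨ha0.trans_le hw.1, hwt⟩, ?_⟩
  rintro v ⟨hv0, hvt⟩
  have hw0 := ha0.trans_le hw.1
  simp only at hwt
  rcases lt_trichotomy v w with hlt | heq | hlt
  · linarith [hanti v w hv0 hlt]
  · exact heq
  · linarith [hanti w v hw0 hlt]

section main
variable {ψ : ℝ → ℝ} {γ : ℝ} {ψinv : ℝ → ℝ}

lemma aux_pos (hmono : StrictMonoOn ψ (Set.Ici γ)) (hinv₁ : ∀ y : ℝ, 0 ≤ y → γ ≤ ψinv y ∧ ψ (ψinv y) = y)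
    {μ x : ℝ} (hμ : 0 ≤ μ) (hx : 0 < x) : 0 < ψ (ψinv μ + x) - μ := by
  obtain ⟨h1, h2⟩ := hinv₁ μ hμ
  have := hmono (show ψinv μ ∈ Set.Ici γ from h1)
    (show ψinv μ + x ∈ Set.Ici γ by simp only [Set.mem_Ici]; linarith)
    (by linarith : ψinv μ < ψinv μ + x)
  linarith

lemma aux_image (hmono : StrictMonoOn ψ (Set.Ici γ))
    (hinv₁ : ∀ y : ℝ, 0 ≤ y → γ ≤ ψinv y ∧ ψ (ψinv y) = y)
    {μ w : ℝ} (hμ : 0 ≤ μ) (hw : 0 < w) :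
    (fun x => ψ (ψinv μ + x) - μ) '' Set.Ioi w = Set.Ioi (ψ (ψinv μ + w) - μ) := by
  obtain ⟨h1, h2⟩ := hinv₁ μ hμ
  have hp := aux_pos hmono hinv₁ hμ hw
  have hw' : ψinv μ + w ∈ Set.Ici γ := by simp only [Set.mem_Ici]; linarith
  ext y
  simp only [Set.mem_image, Set.mem_Ioi]
  constructor
  · rintro ⟨x, hx, rfl⟩
    have := hmono hw' (show ψinv μ + x ∈ Set.Ici γ by simp only [Set.mem_Ici]; linarith)
      (by linarith : ψinv μ + w < ψinv μ + x)
    linarith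
  · intro hy
    obtain ⟨h3, h4⟩ := hinv₁ (μ + y) (by linarith)
    refine ⟨ψinv (μ + y) - ψinv μ, ?_, ?_⟩
    · have : ψinv μ + w < ψinv (μ + y) := (hmono.lt_iff_lt hw' h3).1 (by rw [h4]; linarith)
      linarith
    · rw [add_sub_cancel, h4]; ring

lemma aux_integrable (hγ0 : 0 ≤ γ) (hdiff : ∀ c, 0 < c → DifferentiableAt ℝ ψ c)
    (hmono : StrictMonoOn ψ (Set.Ici γ))
    (htop : Filter.Tendsto ψ Filter.atTop Filter.atTop)
    (hext : ∃ c₀ : ℝ, γ < c₀ ∧ MeasureTheory.IntegrableOn (fun c => (ψ c)⁻¹) (Set.Ioi c₀))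
    (hinv₁ : ∀ y : ℝ, 0 ≤ y → γ ≤ ψinv y ∧ ψ (ψinv y) = y)
    {μ w : ℝ} (hμ : 0 ≤ μ) (hw : 0 < w) :
    IntegrableOn (fun x => (ψ (ψinv μ + x) - μ)⁻¹) (Set.Ioi w) := by
  obtain ⟨c₀, hc₀, hi⟩ := hext
  obtain ⟨h1, h2⟩ := hinv₁ μ hμ
  have hcont : ContinuousOn (fun x => (ψ (ψinv μ + x) - μ)⁻¹) (Set.Ici w) := by
    refine ContinuousOn.inv₀ ?_ fun x hx => (aux_pos hmono hinv₁ hμ (hw.trans_le hx)).ne'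
    refine ContinuousOn.sub ?_ continuousOn_const
    intro x hx
    have hx' : 0 < ψinv μ + x := by have := hw.trans_le hx; linarith
    have : ContinuousAt (fun x => ψ (ψinv μ + x)) x :=
      ContinuousAt.comp (g := ψ) (hdiff _ hx').continuousAt (by fun_prop)
    exact this.continuousWithinAt
  obtain ⟨A, hA⟩ := Filter.eventually_atTop.1 ((htop.eventually_ge_atTop (2 * μ + 1)))
  set B := max w (max (A - ψinv μ) (c₀ - ψinv μ)) with hB
  have hBw : w ≤ B := le_max_left _ _
  have hBA : A - ψinv μ ≤ B := (le_max_left _ _).trans (le_max_right _ _)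
  have hBc : c₀ - ψinv μ ≤ B := (le_max_right _ _).trans (le_max_right _ _)
  rw [← Set.Ioc_union_Ioi_eq_Ioi hBw]
  refine IntegrableOn.union ?_ ?_
  · exact ((hcont.mono Set.Icc_subset_Ici_self).integrableOn_Icc).mono_set Set.Ioc_subset_Icc_self
  · have ht : IntegrableOn (fun x => (ψ (ψinv μ + x))⁻¹) (Set.Ioi (c₀ - ψinv μ)) := by
      have := (MeasurePreserving.integrableOn_comp_preimage
        (measurePreserving_add_left volume (ψinv μ))
        (measurableEmbedding_addLeft (ψinv μ)) (f := fun c => (ψ c)⁻¹) (s := Set.Ioi c₀)).2 hi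
      simpa [Function.comp_def, Set.preimage_const_add_Ioi] using this
    have ht2 := (ht.mono_set (Set.Ioi_subset_Ioi hBc)).const_mul 2
    refine Integrable.mono' ht2 ?_ ?_
    · exact (hcont.mono (fun x hx => hBw.trans (le_of_lt hx))).aestronglyMeasurable measurableSet_Ioi
    · refine (ae_restrict_iff' measurableSet_Ioi).2 (Filter.Eventually.of_forall fun x hx => ?_)
      have hx' : B < x := hx
      have hb := hA (ψinv μ + x) (by linarith)
      have hp : 0 < ψ (ψinv μ + x) - μ := by linarith
      rw [Real.norm_of_nonneg (by positivity)]
      rw [← div_eq_mul_inv, inv_eq_one_div, div_le_div_iff₀ hp (by linarith)]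
      linarith

lemma aux_deriv_pos (hγ0 : 0 ≤ γ) (hconv : ConvexOn ℝ (Set.Ici 0) ψ)
    (hdiff : ∀ c, 0 < c → DifferentiableAt ℝ ψ c)
    (hmono : StrictMonoOn ψ (Set.Ici γ)) {c : ℝ} (hc : γ < c) : 0 < deriv ψ c := by
  have hs := hconv.slope_le_deriv (x := γ) (y := c) hγ0 (hγ0.trans hc.le) hc
    (hdiff c (hγ0.trans_lt hc))
  refine lt_of_lt_of_le ?_ hs
  rw [slope_def_field]
  have := hmono (Set.self_mem_Ici) (show c ∈ Set.Ici γ from hc.le) hc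
  exact div_pos (by linarith) (by linarith)

lemma aux_dw {c : ℝ} (hc : 0 < c) : derivWithin ψ (Set.Ioi 0) c = deriv ψ c :=
  derivWithin_of_mem_nhds (Ioi_mem_nhds hc)

lemma aux_cov (hγ0 : 0 ≤ γ) (hconv : ConvexOn ℝ (Set.Ici 0) ψ)
    (hdiff : ∀ c, 0 < c → DifferentiableAt ℝ ψ c)
    (hmono : StrictMonoOn ψ (Set.Ici γ))
    (htop : Filter.Tendsto ψ Filter.atTop Filter.atTop)
    (hext : ∃ c₀ : ℝ, γ < c₀ ∧ MeasureTheory.IntegrableOn (fun c => (ψ c)⁻¹) (Set.Ioi c₀))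
    (hinv₁ : ∀ y : ℝ, 0 ≤ y → γ ≤ ψinv y ∧ ψ (ψinv y) = y)
    (hinv₂ : ∀ c : ℝ, γ ≤ c → ψinv (ψ c) = c)
    {μ w : ℝ} (hμ : 0 ≤ μ) (hw : 0 < w) :
    IntegrableOn (fun y => (y * derivWithin ψ (Set.Ioi 0) (ψinv (μ + y)))⁻¹)
      (Set.Ioi (ψ (ψinv μ + w) - μ)) ∧
    (∫ x in Set.Ioi w, (ψ (ψinv μ + x) - μ)⁻¹)
        = ∫ y in Set.Ioi (ψ (ψinv μ + w) - μ),
            (y * derivWithin ψ (Set.Ioi 0) (ψinv (μ + y)))⁻¹ := by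
  obtain ⟨h1, h2⟩ := hinv₁ μ hμ
  have hd : ∀ x ∈ Set.Ioi w, HasDerivWithinAt (fun x => ψ (ψinv μ + x) - μ)
      (deriv ψ (ψinv μ + x)) (Set.Ioi w) x := by
    intro x hx
    have hx' : w < x := hx
    have := (hdiff (ψinv μ + x) (by linarith)).hasDerivAt
    exact ((this.comp_const_add (ψinv μ) x).sub_const μ).hasDerivWithinAt
  have hinj : Set.InjOn (fun x => ψ (ψinv μ + x) - μ) (Set.Ioi w) := by
    intro x hx y hy hxy
    have hx' : w < x := hx
    have hy' : w < y := hy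
    have := hmono.injOn (show ψinv μ + x ∈ Set.Ici γ by simp only [Set.mem_Ici]; linarith)
      (show ψinv μ + y ∈ Set.Ici γ by simp only [Set.mem_Ici]; linarith)
      (by simpa using hxy)
    linarith
  have heq : Set.EqOn (fun x => |deriv ψ (ψinv μ + x)| •
      ((ψ (ψinv μ + x) - μ) * derivWithin ψ (Set.Ioi 0) (ψinv (μ + (ψ (ψinv μ + x) - μ))))⁻¹)
      (fun x => (ψ (ψinv μ + x) - μ)⁻¹) (Set.Ioi w) := by
    intro x hx
    have hx' : w < x := hx
    have hp := aux_pos hmono hinv₁ hμ (hw.trans hx')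
    have hD := aux_deriv_pos hγ0 hconv hdiff hmono (c := ψinv μ + x) (by linarith)
    simp only [smul_eq_mul]
    rw [add_sub_cancel, hinv₂ _ (by linarith), aux_dw (by linarith), abs_of_pos hD]
    field_simp
  rw [← aux_image hmono hinv₁ hμ hw]
  constructor
  · rw [integrableOn_image_iff_integrableOn_abs_deriv_smul measurableSet_Ioi hd hinj]
    exact (aux_integrable hγ0 hdiff hmono htop hext hinv₁ hμ hw).congr_fun heq.symm measurableSet_Ioi
  · rw [integral_image_eq_integral_abs_deriv_smul measurableSet_Ioi hd hinj]
    exact (setIntegral_congr_fun measurableSet_Ioi heq).symm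

lemma aux_deriv_unbounded (hγ0 : 0 ≤ γ) (hγroot : ψ γ = 0) (hconv : ConvexOn ℝ (Set.Ici 0) ψ)
    (hdiff : ∀ c, 0 < c → DifferentiableAt ℝ ψ c)
    (hmono : StrictMonoOn ψ (Set.Ici γ))
    (hext : ∃ c₀ : ℝ, γ < c₀ ∧ MeasureTheory.IntegrableOn (fun c => (ψ c)⁻¹) (Set.Ioi c₀)) (M : ℝ) :
    ∃ c, γ < c ∧ M < deriv ψ c := by
  by_contra! hcon
  obtain ⟨c₀, hc₀, hi⟩ := hext
  have hb : ∀ c, γ < c → ψ c ≤ M * (c - γ) := by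
    intro c hc
    have hs := hconv.slope_le_deriv (x := γ) (y := c) hγ0 (hγ0.trans hc.le) hc
      (hdiff c (hγ0.trans_lt hc))
    have := hs.trans (hcon c hc)
    rw [slope_def_field, hγroot, sub_zero, div_le_iff₀ (by linarith)] at this
    exact this
  have hM : 0 < M := lt_of_lt_of_le (aux_deriv_pos hγ0 hconv hdiff hmono hc₀) (hcon c₀ hc₀)
  have : IntegrableOn (fun c : ℝ => c⁻¹) (Set.Ioi c₀) := by
    refine Integrable.mono' (hi.const_mul M) (by fun_prop) ?_
    refine (ae_restrict_iff' measurableSet_Ioi).2 (Filter.Eventually.of_forall fun c hc => ?_)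
    have hc' : c₀ < c := hc
    have hp : 0 < ψ c := by
      have := hmono (Set.self_mem_Ici) (show c ∈ Set.Ici γ by simp only [Set.mem_Ici]; linarith)
        (hc₀.trans hc')
      linarith
    have hc0 : 0 < c := by linarith
    rw [Real.norm_of_nonneg (by positivity), ← div_eq_mul_inv, inv_eq_one_div,
      div_le_div_iff₀ hc0 hp]
    have := hb c (by linarith)
    nlinarith
  exact not_integrableOn_Ioi_inv this

lemma aux_tail_tendsto (hγ0 : 0 ≤ γ) (hγroot : ψ γ = 0) (hconv : ConvexOn ℝ (Set.Ici 0) ψ)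
    (hdiff : ∀ c, 0 < c → DifferentiableAt ℝ ψ c)
    (hmono : StrictMonoOn ψ (Set.Ici γ))
    (htop : Filter.Tendsto ψ Filter.atTop Filter.atTop)
    (hext : ∃ c₀ : ℝ, γ < c₀ ∧ MeasureTheory.IntegrableOn (fun c => (ψ c)⁻¹) (Set.Ioi c₀))
    (hinv₁ : ∀ y : ℝ, 0 ≤ y → γ ≤ ψinv y ∧ ψ (ψinv y) = y)
    (hinv₂ : ∀ c : ℝ, γ ≤ c → ψinv (ψ c) = c)
    {ε : ℝ} (hε : 0 < ε) :
    (∀ μ, 0 ≤ μ → IntegrableOn (fun y => (y * derivWithin ψ (Set.Ioi 0) (ψinv (μ + y)))⁻¹)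
      (Set.Ioi ε)) ∧
    Filter.Tendsto (fun μ => ∫ y in Set.Ioi ε,
      (y * derivWithin ψ (Set.Ioi 0) (ψinv (μ + y)))⁻¹) Filter.atTop (nhds 0) := by
  have hgt : ∀ a b, 0 ≤ a → a < b → ψinv a < ψinv b := by
    intro a b ha hab
    obtain ⟨h1, h2⟩ := hinv₁ a ha
    obtain ⟨h3, h4⟩ := hinv₁ b (ha.trans hab.le)
    exact (hmono.lt_iff_lt h1 h3).1 (by rw [h2, h4]; exact hab)
  have hγinv : ψinv 0 = γ := by rw [← hγroot]; exact hinv₂ γ le_rfl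
  have hdm : MonotoneOn (deriv ψ) (Set.Ioi 0) :=
    (hconv.subset Set.Ioi_subset_Ici_self (convex_Ioi 0)).monotoneOn_deriv fun x hx => hdiff x hx
  have hint : ∀ μ, 0 ≤ μ → IntegrableOn
      (fun y => (y * derivWithin ψ (Set.Ioi 0) (ψinv (μ + y)))⁻¹) (Set.Ioi ε) := by
    intro μ hμ
    have hw : 0 < ψinv (μ + ε) - ψinv μ := by linarith [hgt μ (μ + ε) hμ (by linarith)]
    have := (aux_cov hγ0 hconv hdiff hmono htop hext hinv₁ hinv₂ hμ hw).1
    rwa [add_sub_cancel, (hinv₁ (μ + ε) (by linarith)).2, add_sub_cancel_left] at this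
  refine ⟨hint, ?_⟩
  have hγlt : ∀ y, 0 < y → γ < ψinv y := fun y hy => by
    have := hgt 0 y le_rfl hy
    rwa [hγinv] at this
  have hz : (∫ y in Set.Ioi ε, (0 : ℝ)) = 0 := by simp
  rw [show nhds (0 : ℝ) = nhds (∫ y in Set.Ioi ε, (0 : ℝ)) by rw [hz]]
  refine tendsto_integral_filter_of_dominated_convergence
    (fun y => (y * derivWithin ψ (Set.Ioi 0) (ψinv (0 + y)))⁻¹) ?_ ?_ (hint 0 le_rfl) ?_
  · filter_upwards [Filter.eventually_ge_atTop 0] with μ hμ using (hint μ hμ).aestronglyMeasurable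
  · filter_upwards [Filter.eventually_ge_atTop 0] with μ hμ
    refine (ae_restrict_iff' measurableSet_Ioi).2 (Filter.Eventually.of_forall fun y hy => ?_)
    have hy0 : 0 < y := hε.trans hy
    have g1 := hγlt (0 + y) (by linarith)
    have g2 := hγlt (μ + y) (by linarith)
    have d1 := aux_deriv_pos hγ0 hconv hdiff hmono g1
    have d2 := aux_deriv_pos hγ0 hconv hdiff hmono g2
    rw [aux_dw (by linarith), aux_dw (by linarith), Real.norm_of_nonneg (by positivity)]
    have hle : deriv ψ (ψinv (0 + y)) ≤ deriv ψ (ψinv (μ + y)) := by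
      refine hdm (Set.mem_Ioi.2 (by linarith)) (Set.mem_Ioi.2 (by linarith)) ?_
      rcases hμ.eq_or_lt with rfl | h
      · exact le_rfl
      · exact (hgt _ _ (by linarith) (by linarith)).le
    gcongr
  · refine (ae_restrict_iff' measurableSet_Ioi).2 (Filter.Eventually.of_forall fun y hy => ?_)
    have hy0 : 0 < y := hε.trans hy
    refine Filter.Tendsto.inv_tendsto_atTop (Filter.Tendsto.const_mul_atTop hy0 ?_)
    rw [Filter.tendsto_atTop]
    intro M
    obtain ⟨c, hc, hMc⟩ := aux_deriv_unbounded hγ0 hγroot hconv hdiff hmono hext M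
    have hψc : 0 < ψ c := by
      have := hmono (Set.self_mem_Ici) (show c ∈ Set.Ici γ from hc.le) hc
      linarith
    filter_upwards [Filter.eventually_ge_atTop (ψ c)] with μ hμ
    have g := hgt (ψ c) (μ + y) hψc.le (by linarith)
    rw [hinv₂ c hc.le] at g
    rw [aux_dw (by linarith)]
    exact hMc.le.trans (hdm (show 0 < c by linarith) (Set.mem_Ioi.2 (by linarith)) g.le)

end main

/-- For a branching mechanism `ψ` strictly increasing on `[γ,∞)` (`γ` its largest root) with
`ψ(c) → ∞`, satisfying the extinction condition: (i) for every `μ ≥ 0` and `w > 0`, writing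
`p = ψ^{-1}(μ)`, one has `∫_w^∞ dx/(ψ(p+x)-μ) = ∫_{ψ(p+w)-μ}^∞ dy/(y ψ'(ψ^{-1}(μ+y)))`;
(ii) for every `t > 0`, there is for each `μ ≥ 0` a unique `w_μ(t) > 0` with
`∫_{w_μ(t)}^∞ dx/(ψ(p+x)-μ) = t`, and `ψ(ψ^{-1}(μ) + w_μ(t)) - μ → 0` as `μ → ∞`. -/
theorem change_of_variables_and_limit (ψ : ℝ → ℝ) (hψ : IsBranchingMechanism ψ) (γ : ℝ)
    (hγ0 : 0 ≤ γ) (hγroot : ψ γ = 0) (hγlargest : ∀ c : ℝ, 0 ≤ c → ψ c ≤ 0 → c ≤ γ)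
    (hmono : StrictMonoOn ψ (Set.Ici γ))
    (htop : Filter.Tendsto ψ Filter.atTop Filter.atTop)
    (hext : ∃ c₀ : ℝ, γ < c₀ ∧ MeasureTheory.IntegrableOn (fun c => (ψ c)⁻¹) (Set.Ioi c₀))
    (ψinv : ℝ → ℝ) (hinv₁ : ∀ y : ℝ, 0 ≤ y → γ ≤ ψinv y ∧ ψ (ψinv y) = y)
    (hinv₂ : ∀ c : ℝ, γ ≤ c → ψinv (ψ c) = c) :
    (∀ μ : ℝ, 0 ≤ μ → ∀ w : ℝ, 0 < w →
      (∫ x in Set.Ioi w, (ψ (ψinv μ + x) - μ)⁻¹)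
        = ∫ y in Set.Ioi (ψ (ψinv μ + w) - μ),
            (y * derivWithin ψ (Set.Ioi 0) (ψinv (μ + y)))⁻¹) ∧
    ∀ t : ℝ, 0 < t →
      (∀ μ : ℝ, 0 ≤ μ →
        ∃! w : ℝ, 0 < w ∧ (∫ x in Set.Ioi w, (ψ (ψinv μ + x) - μ)⁻¹) = t) ∧
      (∀ W : ℝ → ℝ,
        (∀ μ : ℝ, 0 ≤ μ →
          0 < W μ ∧ (∫ x in Set.Ioi (W μ), (ψ (ψinv μ + x) - μ)⁻¹) = t) →
        Filter.Tendsto (fun μ => ψ (ψinv μ + W μ) - μ) Filter.atTop (nhds 0)) := by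
  obtain ⟨α, β, ν, hbm⟩ := hψ
  have hconv := bm_convex hbm
  have hdiff : ∀ c, 0 < c → DifferentiableAt ℝ ψ c := fun c hc => bm_diff hbm c hc
  refine ⟨fun μ hμ w hw =>
    (aux_cov hγ0 hconv hdiff hmono htop hext hinv₁ hinv₂ hμ hw).2, fun t ht => ⟨?_, ?_⟩⟩
  · intro μ hμ
    obtain ⟨h1, h2⟩ := hinv₁ μ hμ
    refine tail_exists_unique (fun x => (ψ (ψinv μ + x) - μ)⁻¹)
      (fun x hx => inv_pos.2 (aux_pos hmono hinv₁ hμ hx))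
      (fun w hw => aux_integrable hγ0 hdiff hmono htop hext hinv₁ hμ hw)
      (ψ (ψinv μ + 1) - μ) (aux_pos hmono hinv₁ hμ one_pos) ?_ t ht
    intro x hx hx1
    have hp := aux_pos hmono hinv₁ hμ hx
    refine inv_anti₀ hp ?_
    have hc := hconv.2 (show ψinv μ ∈ Set.Ici 0 from hγ0.trans h1)
      (show ψinv μ + 1 ∈ Set.Ici 0 by simp only [Set.mem_Ici]; linarith)
      (show 0 ≤ 1 - x by linarith) hx.le (by ring)
    simp only [smul_eq_mul] at hc
    rw [show (1 - x) * ψinv μ + x * (ψinv μ + 1) = ψinv μ + x by ring, h2] at hc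
    linarith
  · intro W hW
    rw [Metric.tendsto_nhds]
    intro ε hε
    obtain ⟨hint, hlim⟩ :=
      aux_tail_tendsto hγ0 hγroot hconv hdiff hmono htop hext hinv₁ hinv₂ hε
    filter_upwards [hlim.eventually (Iio_mem_nhds ht), Filter.eventually_ge_atTop 0] with μ hlt hμ
    obtain ⟨hW0, hWt⟩ := hW μ hμ
    have hp := aux_pos hmono hinv₁ hμ hW0
    rw [Real.dist_eq, sub_zero, abs_of_pos hp]
    by_contra! hge
    rw [(aux_cov hγ0 hconv hdiff hmono htop hext hinv₁ hinv₂ hμ hW0).2] at hWt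
    have hle := setIntegral_mono_set (hint μ hμ) (by
      refine (ae_restrict_iff' measurableSet_Ioi).2 (Filter.Eventually.of_forall fun y hy => ?_)
      have hy0 : 0 < y := hε.trans hy
      obtain ⟨h1, h2⟩ := hinv₁ (μ + y) (by linarith)
      have hg : γ < ψinv (μ + y) := by
        refine lt_of_le_of_ne h1 fun h => ?_
        rw [← h, hγroot] at h2
        linarith
      have := aux_deriv_pos hγ0 hconv hdiff hmono hg
      simp only [Pi.zero_apply]
      rw [aux_dw (by linarith)]
      positivity) (Set.Ioi_subset_Ioi hge).eventuallyLE
    linarith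
end
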